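/- arXiv:1005.5591 — 4 statements merged into one kernel-verified Lean document; each statement's English description precedes it below -/
import Mathlib

section
/- In the construction below, every generator is an involution (g_i∘g_i = e and g′_i∘g′_i = e for all i ∈ [n]), the 2n generators {g_i, g′_i : i ∈ [n]} pairwise commute, and consequently every element of the subgroup H generated by them can be written as ∏_{i=1}^n g_i^{z_i} ∘ (g′_i)^{z′_i} for some exponents z_i, z′_i ∈ {0,1}. -/
/- ### The reduction from NAESAT: gadgets and generators.

A 3-CNF formula with `m` clauses over `n` variables is represented by
`φ : Fin m → Fin 3 → Fin n × Bool`: the `k`-th literal of clause `c_j` is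
`φ j k = (i, pos)`, meaning `x_{i+1}` if `pos = true` and `¬x_{i+1}` if `pos = false`
(variable indices are zero-based here: `i : Fin n` stands for the variable `x_{i+1}`).
All permutations act on `ℕ`, supported on the symbols `{1,…,N}` with `N = 48m+18n`. -/

/-- The Chebyshev weight of a permutation of `{1,…,N}` (represented as a permutation
of `ℕ` supported on `{1,…,N}`): `w(π) = max_{i∈{1,…,N}} |π(i) − i|`. -/
def chebWeight (N : ℕ) (π : Equiv.Perm ℕ) : ℕ :=
  (Finset.Icc 1 N).sup fun i => Nat.dist (π i) i

/-- The product of the disjoint transpositions `(r+a, r+b)` over the pairs `(a,b)`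
in the list (i.e. the shift by `r` of the product of the transpositions `(a,b)`). -/
def swapsAt (r : ℕ) (l : List (ℕ × ℕ)) : Equiv.Perm ℕ :=
  (l.map fun p => Equiv.swap (r + p.1) (r + p.2)).prod

/-- `hPerm r k` is `s_r(h_{k+1})` for `k : Fin 3`. -/
def hPerm (r : ℕ) : Fin 3 → Equiv.Perm ℕ
  | 0 => swapsAt r [(1,3),(5,7),(2,4),(6,8),(9,13),(11,15),(10,14),(12,16),(17,23),(19,21),(18,24),(20,22)]
  | 1 => swapsAt r [(1,5),(3,7),(2,6),(4,8),(9,15),(11,13),(10,16),(12,14),(17,19),(21,23),(18,20),(22,24)]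
  | 2 => swapsAt r [(1,7),(3,5),(2,8),(4,6),(9,11),(13,15),(10,12),(14,16),(17,21),(19,23),(18,22),(20,24)]

/-- `gPerm r` is `s_r(g)`. -/
def gPerm (r : ℕ) : Equiv.Perm ℕ :=
  swapsAt r [(1,8),(2,7),(3,6),(4,5),(9,16),(10,15),(11,14),(12,13),(17,24),(18,23),(19,22),(20,21)]

/-- The clause gadget `h_{j+1,k+1,t}` for the zero-based clause index `j` and literal
position `k : Fin 3`: `h_{j,k,T} = s_{48(j−1)}(g∘h_k)` and
`h_{j,k,F} = s_{48(j−1)+24}(g∘h_k)` (with 1-based `j` in the paper's notation). -/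
def clauseGadget (j : ℕ) (k : Fin 3) (t : Bool) : Equiv.Perm ℕ :=
  gPerm (48 * j + if t then 0 else 24) * hPerm (48 * j + if t then 0 else 24) k

/-- The variable gadget `v_{i+1,t}` for the zero-based variable index `i`:
`v_{i,T} = s_{48m−10+10i}(v_T)` and `v_{i,F} = s_{48m−10+10i}(v_F)` (1-based `i`),
where `v_T = (1,4)(7,10)` and `v_F = (1,7)(4,10)`. -/
def varGadget (m i : ℕ) (t : Bool) : Equiv.Perm ℕ :=
  if t then swapsAt (48 * m + 10 * i) [(1,4),(7,10)]
  else swapsAt (48 * m + 10 * i) [(1,7),(4,10)]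

/-- The assignment gadget `u_{i+1}` for the zero-based variable index `i`, with
`b₂ = 48m+10n`: `u_i = (b₂+8(i−1)+1, b₂+8(i−1)+8)(b₂+8i+1, b₂+8i+8)` for `1 ≤ i < n`
and `u_n = (b₂+8(n−1)+1, b₂+8(n−1)+8)(b₂+1, b₂+8)` (1-based `i`). -/
def assignGadget (m n i : ℕ) : Equiv.Perm ℕ :=
  Equiv.swap (48 * m + 10 * n + 8 * i + 1) (48 * m + 10 * n + 8 * i + 8) *
  Equiv.swap (48 * m + 10 * n + 8 * ((i + 1) % n) + 1) (48 * m + 10 * n + 8 * ((i + 1) % n) + 8)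

/-- The generator `g_{i+1}` (when `b = true`) resp. `g'_{i+1}` (when `b = false`):
`g_i = v_{i,T} ∘ u_i ∘ ∏_{(i,j,k)∈P} h_{j,k,T} ∘ ∏_{(i,j,k)∈Q} h_{j,k,F}` and
`g'_i = v_{i,F} ∘ u_i ∘ ∏_{(i,j,k)∈P} h_{j,k,F} ∘ ∏_{(i,j,k)∈Q} h_{j,k,T}`,
where `P` (resp. `Q`) is the set of `(i,j,k)` such that `x_i` (resp. `¬x_i`) is the
`k`-th literal of `c_j`.  (All clause gadgets commute, so the product over the
occurrences of the variable may be taken in order of `(j,k)`.) -/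
def gen (n m : ℕ) (φ : Fin m → Fin 3 → Fin n × Bool) (i : Fin n) (b : Bool) :
    Equiv.Perm ℕ :=
  varGadget m (i : ℕ) b * assignGadget m n (i : ℕ) *
    ((List.finRange m).map fun j =>
      ((List.finRange 3).map fun k =>
        if (φ j k).1 = i then clauseGadget (j : ℕ) k ((φ j k).2 == b) else 1).prod).prod

/-- The subgroup `H` of `S_N` generated by `{g_i, g'_i : i ∈ [n]}`. -/
def Hgroup (n m : ℕ) (φ : Fin m → Fin 3 → Fin n × Bool) : Subgroup (Equiv.Perm ℕ) :=
  Subgroup.closure (Set.range fun p : Fin n × Bool => gen n m φ p.1 p.2)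

/-- Embeds permutations of `Fin s` as permutations of `ℕ` moving only `r+1,…,r+s`. -/
noncomputable def blockHom (s r : ℕ) : Equiv.Perm (Fin s) →* Equiv.Perm ℕ :=
  Equiv.Perm.viaEmbeddingHom ⟨fun c => r + (c + 1), fun a b h => by
    simpa [Fin.ext_iff] using h⟩

theorem blockHom_apply_image {s r : ℕ} (σ : Equiv.Perm (Fin s)) (c : Fin s) :
    blockHom s r σ (r + (c + 1)) = r + (σ c + 1) :=
  Equiv.Perm.viaEmbedding_apply σ _ c

theorem blockHom_apply_of_notMem {s r : ℕ} (σ : Equiv.Perm (Fin s)) {x : ℕ}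
    (hx : x ≤ r ∨ r + s < x) : blockHom s r σ x = x := by
  refine Equiv.Perm.viaEmbedding_apply_of_notMem σ _ x ?_
  rintro ⟨c, hc⟩
  have := c.isLt
  change r + (c + 1) = x at hc
  omega

theorem blockHom_swap {s r : ℕ} (a b : Fin s) :
    blockHom s r (Equiv.swap a b) = Equiv.swap (r + (a + 1)) (r + (b + 1)) := by
  ext x
  by_cases hx : x ≤ r ∨ r + s < x
  · rw [blockHom_apply_of_notMem _ hx, Equiv.swap_apply_of_ne_of_ne] <;> omega
  · obtain ⟨c, rfl⟩ : ∃ c : Fin s, x = r + (c + 1) :=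
      ⟨⟨x - r - 1, by omega⟩, (by omega : x = r + (x - r - 1 + 1))⟩
    rw [blockHom_apply_image]
    simp only [Equiv.swap_apply_def, Fin.ext_iff, Nat.add_left_cancel_iff, Nat.add_right_cancel_iff]
    split_ifs <;> rfl

theorem commute_blockHom_of_le {s s' r r' : ℕ} (h : r + s ≤ r')
    (σ : Equiv.Perm (Fin s)) (τ : Equiv.Perm (Fin s')) :
    Commute (blockHom s r σ) (blockHom s' r' τ) := by
  refine Equiv.Perm.Disjoint.commute fun x => ?_
  by_cases hx : x ≤ r'
  · exact Or.inr (blockHom_apply_of_notMem τ (Or.inl hx))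
  · exact Or.inl (blockHom_apply_of_notMem σ (Or.inr (by omega)))

/-- The product of the transpositions `(a,b)` in the list, on `{1,…,s+1}` numbered from zero. -/
def blockSwaps (s : ℕ) (l : List (ℕ × ℕ)) : Equiv.Perm (Fin (s + 1)) :=
  (l.map fun p => Equiv.swap (Fin.ofNat (s + 1) (p.1 - 1)) (Fin.ofNat (s + 1) (p.2 - 1))).prod

theorem swapsAt_eq_blockHom (s r : ℕ) (l : List (ℕ × ℕ))
    (hl : ∀ p ∈ l, (1 ≤ p.1 ∧ p.1 ≤ s + 1) ∧ (1 ≤ p.2 ∧ p.2 ≤ s + 1)) :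
    swapsAt r l = blockHom (s + 1) r (blockSwaps s l) := by
  rw [swapsAt, blockSwaps, map_list_prod, List.map_map]
  refine congrArg List.prod (List.map_congr_left fun p hp => ?_)
  obtain ⟨⟨h1, h2⟩, h3, h4⟩ := hl p hp
  rw [Function.comp_apply, blockHom_swap, Fin.val_ofNat, Fin.val_ofNat,
    Nat.mod_eq_of_lt (by omega), Nat.mod_eq_of_lt (by omega), Nat.sub_add_cancel h1,
    Nat.sub_add_cancel h3]

/-- The permutation `h_{k+1}` on `Fin 24`. -/
def hBlockPerm : Fin 3 → Equiv.Perm (Fin 24)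
  | 0 => blockSwaps 23 [(1,3),(5,7),(2,4),(6,8),(9,13),(11,15),(10,14),(12,16),(17,23),(19,21),
      (18,24),(20,22)]
  | 1 => blockSwaps 23 [(1,5),(3,7),(2,6),(4,8),(9,15),(11,13),(10,16),(12,14),(17,19),(21,23),
      (18,20),(22,24)]
  | 2 => blockSwaps 23 [(1,7),(3,5),(2,8),(4,6),(9,11),(13,15),(10,12),(14,16),(17,21),(19,23),
      (18,22),(20,24)]

/-- The permutation `g ∘ h_{k+1}` on `Fin 24`. -/
def clausePerm (k : Fin 3) : Equiv.Perm (Fin 24) :=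
  blockSwaps 23 [(1,8),(2,7),(3,6),(4,5),(9,16),(10,15),(11,14),(12,13),(17,24),(18,23),(19,22),
    (20,21)] *
  hBlockPerm k

theorem clauseGadget_eq_blockHom (j : ℕ) (k : Fin 3) (t : Bool) :
    clauseGadget j k t = blockHom 24 (48 * j + if t then 0 else 24) (clausePerm k) := by
  rw [clauseGadget, clausePerm, map_mul, gPerm, swapsAt_eq_blockHom 23 _ _ (by decide)]
  congr 1
  fin_cases k <;> exact swapsAt_eq_blockHom 23 _ _ (by decide)

theorem clausePerm_commute (k k' : Fin 3) : Commute (clausePerm k) (clausePerm k') := by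
  revert k k'
  unfold Commute SemiconjBy
  decide +kernel

theorem clausePerm_mul_self (k : Fin 3) : clausePerm k * clausePerm k = 1 := by
  revert k
  decide +kernel

/-- The permutations `v_T` and `v_F` on `Fin 10`. -/
def varPerm (t : Bool) : Equiv.Perm (Fin 10) :=
  if t then blockSwaps 9 [(1,4),(7,10)] else blockSwaps 9 [(1,7),(4,10)]

theorem varGadget_eq_blockHom (m i : ℕ) (t : Bool) :
    varGadget m i t = blockHom 10 (48 * m + 10 * i) (varPerm t) := by
  cases t <;> exact swapsAt_eq_blockHom 9 _ _ (by decide)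

theorem varPerm_commute (t t' : Bool) : Commute (varPerm t) (varPerm t') := by
  revert t t'
  unfold Commute SemiconjBy
  decide +kernel

theorem varPerm_mul_self (t : Bool) : varPerm t * varPerm t = 1 := by
  revert t
  decide +kernel

/-- The building blocks of the generators, for a formula with `m` clauses over `n` variables. -/
inductive IsGadget (n m : ℕ) : Equiv.Perm ℕ → Prop
  | clause (j : Fin m) (k : Fin 3) (t : Bool) : IsGadget n m (clauseGadget j k t)
  | var (i : Fin n) (t : Bool) : IsGadget n m (varGadget m i t)
  | assign (i : ℕ) : IsGadget n m (Equiv.swap (48 * m + 10 * n + 8 * i + 1)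
      (48 * m + 10 * n + 8 * i + 8))

theorem assignSwap_eq_blockHom (r : ℕ) :
    Equiv.swap (r + 1) (r + 8) = blockHom 8 r (Equiv.swap 0 7) :=
  (blockHom_swap (s := 8) (r := r) 0 7).symm

theorem IsGadget.mul_self {n m : ℕ} {π : Equiv.Perm ℕ} (h : IsGadget n m π) : π * π = 1 := by
  cases h with
  | clause j k t => rw [clauseGadget_eq_blockHom, ← map_mul, clausePerm_mul_self, map_one]
  | var i t => rw [varGadget_eq_blockHom, ← map_mul, varPerm_mul_self, map_one]
  | assign i => exact Equiv.swap_mul_self _ _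

theorem clauseGadget_commute (j j' : ℕ) (k k' : Fin 3) (t t' : Bool) :
    Commute (clauseGadget j k t) (clauseGadget j' k' t') := by
  rw [clauseGadget_eq_blockHom, clauseGadget_eq_blockHom]
  generalize hr : 48 * j + (if t then 0 else 24) = r
  generalize hr' : 48 * j' + (if t' then 0 else 24) = r'
  have hcases : r + 24 ≤ r' ∨ r' + 24 ≤ r ∨ r = r' := by split_ifs at hr hr' <;> omega
  rcases hcases with h | h | rfl
  · exact commute_blockHom_of_le h _ _
  · exact (commute_blockHom_of_le h _ _).symm
  · exact (clausePerm_commute k k').map _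

theorem varGadget_commute (m i i' : ℕ) (t t' : Bool) :
    Commute (varGadget m i t) (varGadget m i' t') := by
  rw [varGadget_eq_blockHom, varGadget_eq_blockHom]
  rcases lt_trichotomy i i' with h | rfl | h
  · exact commute_blockHom_of_le (by omega) _ _
  · exact (varPerm_commute t t').map _
  · exact (commute_blockHom_of_le (by omega) _ _).symm

theorem assignSwap_commute (r i i' : ℕ) :
    Commute (Equiv.swap (r + 8 * i + 1) (r + 8 * i + 8))
      (Equiv.swap (r + 8 * i' + 1) (r + 8 * i' + 8)) := by
  rw [assignSwap_eq_blockHom, assignSwap_eq_blockHom]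
  rcases lt_trichotomy i i' with h | rfl | h
  · exact commute_blockHom_of_le (by omega) _ _
  · exact Commute.refl _
  · exact (commute_blockHom_of_le (by omega) _ _).symm

theorem clauseGadget_commute_varGadget {m j : ℕ} (hj : j < m) (i : ℕ) (k : Fin 3) (t t' : Bool) :
    Commute (clauseGadget j k t) (varGadget m i t') := by
  rw [clauseGadget_eq_blockHom, varGadget_eq_blockHom]
  exact commute_blockHom_of_le (by split_ifs <;> omega) _ _

theorem clauseGadget_commute_assignSwap {m j : ℕ} (hj : j < m) (n i : ℕ) (k : Fin 3) (t : Bool) :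
    Commute (clauseGadget j k t) (Equiv.swap (48 * m + 10 * n + 8 * i + 1)
      (48 * m + 10 * n + 8 * i + 8)) := by
  rw [clauseGadget_eq_blockHom, assignSwap_eq_blockHom]
  exact commute_blockHom_of_le (by split_ifs <;> omega) _ _

theorem varGadget_commute_assignSwap {n i : ℕ} (hi : i < n) (m i' : ℕ) (t : Bool) :
    Commute (varGadget m i t) (Equiv.swap (48 * m + 10 * n + 8 * i' + 1)
      (48 * m + 10 * n + 8 * i' + 8)) := by
  rw [varGadget_eq_blockHom, assignSwap_eq_blockHom]
  exact commute_blockHom_of_le (by omega) _ _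

theorem IsGadget.commute {n m : ℕ} {π ρ : Equiv.Perm ℕ} (hπ : IsGadget n m π)
    (hρ : IsGadget n m ρ) : Commute π ρ := by
  cases hπ with
  | clause j k t =>
    cases hρ with
    | clause j' k' t' => exact clauseGadget_commute _ _ _ _ _ _
    | var i t' => exact clauseGadget_commute_varGadget j.isLt _ _ _ _
    | assign i => exact clauseGadget_commute_assignSwap j.isLt _ _ _ _
  | var i t =>
    cases hρ with
    | clause j k t' => exact (clauseGadget_commute_varGadget j.isLt _ _ _ _).symm
    | var i' t' => exact varGadget_commute _ _ _ _ _
    | assign i' => exact varGadget_commute_assignSwap i.isLt _ _ _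
  | assign i =>
    cases hρ with
    | clause j k t => exact (clauseGadget_commute_assignSwap j.isLt _ _ _ _).symm
    | var i' t => exact (varGadget_commute_assignSwap i'.isLt _ _ _).symm
    | assign i' => exact assignSwap_commute _ _ _

theorem gen_mem_closure (n m : ℕ) (φ : Fin m → Fin 3 → Fin n × Bool) (i : Fin n) (b : Bool) :
    gen n m φ i b ∈ Subgroup.closure {π | IsGadget n m π} := by
  have mem {π} (h : IsGadget n m π) : π ∈ Subgroup.closure {π | IsGadget n m π} :=
    Subgroup.subset_closure h
  refine mul_mem (mul_mem (mem (.var i b)) (mul_mem (mem (.assign _)) (mem (.assign _)))) ?_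
  refine list_prod_mem fun x hx => ?_
  obtain ⟨j, -, rfl⟩ := List.mem_map.1 hx
  refine list_prod_mem fun y hy => ?_
  obtain ⟨k, -, rfl⟩ := List.mem_map.1 hy
  split_ifs
  · exact mem (.clause j k _)
  · exact one_mem _

section CommutingInvolutions

variable {G : Type*} [Group G]

theorem commute_of_mem_closure {S : Set G} (hS : ∀ x ∈ S, ∀ y ∈ S, Commute x y) {x y : G}
    (hx : x ∈ Subgroup.closure S) (hy : y ∈ Subgroup.closure S) : Commute x y := by
  induction hx, hy using Subgroup.closure_induction₂ with
  | mem x y hx hy => exact hS x hx y hy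
  | one_left x hx => exact Commute.one_left x
  | one_right x hx => exact Commute.one_right x
  | mul_left x y z hx hy hz h₁ h₂ => exact h₁.mul_left h₂
  | mul_right y z x hy hz hx h₁ h₂ => exact h₁.mul_right h₂
  | inv_left x y hx hy h => exact h.inv_left
  | inv_right x y hx hy h => exact h.inv_right

theorem mul_self_of_mem_closure {S : Set G} (hS : ∀ x ∈ S, ∀ y ∈ S, Commute x y)
    (hS' : ∀ x ∈ S, x * x = 1) {x : G} (hx : x ∈ Subgroup.closure S) : x * x = 1 := by
  induction hx using Subgroup.closure_induction with
  | mem x hx => exact hS' x hx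
  | one => exact one_mul 1
  | mul x y hx hy h₁ h₂ =>
    rw [(commute_of_mem_closure hS hy hx).mul_mul_mul_comm, h₁, h₂, one_mul]
  | inv x hx h => rw [← mul_inv_rev, h, inv_one]

theorem List.prod_map_mul_of_forall_commute {ι : Type*} (l : List ι) (f g : ι → G)
    (h : ∀ i j, Commute (f i) (g j)) :
    (l.map fun i => f i * g i).prod = (l.map f).prod * (l.map g).prod := by
  induction l with
  | nil => simp
  | cons a l ih =>
    have hc : Commute (g a) (l.map f).prod := by
      refine Commute.list_prod_right _ _ fun x hx => ?_
      obtain ⟨i, -, rfl⟩ := List.mem_map.1 hx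
      exact (h i a).symm
    simp only [List.map_cons, List.prod_cons, ih]
    exact hc.mul_mul_mul_comm _ _

theorem pow_mod_two_of_mul_self {x : G} (hx : x * x = 1) (k : ℕ) : x ^ (k % 2) = x ^ k := by
  conv_rhs => rw [← Nat.mod_add_div k 2, pow_add, pow_mul, pow_two, hx, one_pow, mul_one]

theorem exists_prod_of_mem_closure {n : ℕ} (a : Fin n → Bool → G)
    (hcomm : ∀ i i' b b', Commute (a i b) (a i' b')) (hinv : ∀ i b, a i b * a i b = 1) {x : G}
    (hx : x ∈ Subgroup.closure (Set.range fun p : Fin n × Bool => a p.1 p.2)) :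
    ∃ z z' : Fin n → ℕ, (∀ i, z i ≤ 1) ∧ (∀ i, z' i ≤ 1) ∧
      x = ((List.finRange n).map fun i => a i true ^ z i * a i false ^ z' i).prod := by
  have hS : ∀ x ∈ Set.range fun p : Fin n × Bool => a p.1 p.2,
      ∀ y ∈ Set.range fun p : Fin n × Bool => a p.1 p.2, Commute x y := by
    rintro _ ⟨p, rfl⟩ _ ⟨q, rfl⟩
    exact hcomm _ _ _ _
  have hS' : ∀ x ∈ Set.range fun p : Fin n × Bool => a p.1 p.2, x * x = 1 := by
    rintro _ ⟨p, rfl⟩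
    exact hinv _ _
  induction hx using Subgroup.closure_induction with
  | mem x hx =>
    obtain ⟨⟨i, b⟩, rfl⟩ := hx
    refine ⟨fun i' => if i' = i ∧ b = true then 1 else 0,
      fun i' => if i' = i ∧ b = false then 1 else 0, fun _ => by dsimp only; split_ifs <;> simp,
      fun _ => by dsimp only; split_ifs <;> simp, ?_⟩
    rw [List.prod_map_eq_pow_single i _ fun j hj _ => by simp [hj],
      List.count_eq_one_of_mem (List.nodup_finRange n) (List.mem_finRange i)]
    cases b <;> simp
  | one => exact ⟨0, 0, by simp, by simp, by simp⟩
  | mul x y _ _ ihx ihy =>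
    obtain ⟨z, z', -, -, rfl⟩ := ihx
    obtain ⟨w, w', -, -, rfl⟩ := ihy
    refine ⟨fun i => (z i + w i) % 2, fun i => (z' i + w' i) % 2,
      fun i => Nat.le_of_lt_succ (Nat.mod_lt _ two_pos),
      fun i => Nat.le_of_lt_succ (Nat.mod_lt _ two_pos), ?_⟩
    rw [← List.prod_map_mul_of_forall_commute _ _ _ fun i j =>
      (((hcomm _ _ _ _).pow_pow _ _).mul_right ((hcomm _ _ _ _).pow_pow _ _)).mul_left
        (((hcomm _ _ _ _).pow_pow _ _).mul_right ((hcomm _ _ _ _).pow_pow _ _))]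
    refine congrArg List.prod (List.map_congr_left fun i _ => ?_)
    rw [pow_mod_two_of_mul_self (hinv _ _), pow_mod_two_of_mul_self (hinv _ _), pow_add, pow_add]
    exact ((hcomm i i false true).pow_pow _ _).mul_mul_mul_comm _ _
  | inv x hx ih => rwa [inv_eq_of_mul_eq_one_right (mul_self_of_mem_closure hS hS' hx)]

end CommutingInvolutions

/-- Every generator is an involution, the `2n` generators pairwise commute, and
consequently every element of `H` is `∏_{i=1}^n g_i^{z_i} ∘ (g'_i)^{z'_i}` for some
exponents `z_i, z'_i ∈ {0,1}`. -/
theorem generators_involutive_commute (n m : ℕ) (hn : 1 ≤ n) (hm : 1 ≤ m)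
    (φ : Fin m → Fin 3 → Fin n × Bool) :
    (∀ (i : Fin n) (b : Bool), gen n m φ i b * gen n m φ i b = 1) ∧
    (∀ (i i' : Fin n) (b b' : Bool), Commute (gen n m φ i b) (gen n m φ i' b')) ∧
    (∀ π ∈ Hgroup n m φ, ∃ z z' : Fin n → ℕ,
      (∀ i, z i ≤ 1) ∧ (∀ i, z' i ≤ 1) ∧
      π = ((List.finRange n).map fun i =>
            gen n m φ i true ^ z i * gen n m φ i false ^ z' i).prod) := by
  have hS : ∀ x ∈ {π | IsGadget n m π}, ∀ y ∈ {π | IsGadget n m π}, Commute x y :=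
    fun _ hx _ hy => IsGadget.commute hx hy
  have hinv (i : Fin n) (b : Bool) : gen n m φ i b * gen n m φ i b = 1 :=
    mul_self_of_mem_closure hS (fun _ hx => IsGadget.mul_self hx) (gen_mem_closure n m φ i b)
  have hcomm (i i' : Fin n) (b b' : Bool) : Commute (gen n m φ i b) (gen n m φ i' b') :=
    commute_of_mem_closure hS (gen_mem_closure n m φ i b) (gen_mem_closure n m φ i' b')
  exact ⟨hinv, hcomm, fun _ hπ => exists_prod_of_mem_closure (gen n m φ) hcomm hinv hπ⟩
end

section
/- For every i ∈ [n], the product g_i∘g′_i of the two generators associated with the variable x_i has Chebyshev weight exactly 9: w(g_i∘g′_i) = 9. -/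
/-- The permutations of `ℕ` that preserve every block `{8q+1,…,8q+8}` and fix every
symbol beyond `M`. -/
def blockPreserving (M : ℕ) : Submonoid (Equiv.Perm ℕ) where
  carrier := {f | ∀ x, (f x + 7) / 8 = (x + 7) / 8 ∧ (M < x → f x = x)}
  one_mem' := fun _ => ⟨rfl, fun _ => rfl⟩
  mul_mem' := by
    intro f g hf hg x
    refine ⟨(hf _).1.trans (hg x).1, fun hx => ?_⟩
    rw [Equiv.Perm.mul_apply, (hg x).2 hx, (hf x).2 hx]

lemma swap_mem_blockPreserving {M a b : ℕ} (h : (a + 7) / 8 = (b + 7) / 8)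
    (ha : a ≤ M) (hb : b ≤ M) : Equiv.swap a b ∈ blockPreserving M := by
  intro x
  rw [Equiv.swap_apply_def]
  split_ifs <;> omega

lemma swapsAt_mem_blockPreserving {M r : ℕ} (hr : 8 ∣ r) (hM : r + 24 ≤ M)
    {l : List (ℕ × ℕ)}
    (hl : ∀ p ∈ l, (p.1 + 7) / 8 = (p.2 + 7) / 8 ∧ p.1 ≤ 24 ∧ p.2 ≤ 24) :
    swapsAt r l ∈ blockPreserving M := by
  refine Submonoid.list_prod_mem _ fun f hf => ?_
  obtain ⟨p, hp, rfl⟩ := List.mem_map.mp hf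
  have := hl p hp
  exact swap_mem_blockPreserving (by omega) (by omega) (by omega)

lemma clauseGadget_mem_blockPreserving {m j : ℕ} (hj : j < m) (k : Fin 3) (t : Bool) :
    clauseGadget j k t ∈ blockPreserving (48 * m) := by
  have hr : 8 ∣ 48 * j + (if t then 0 else 24) := by split_ifs <;> omega
  have hM : 48 * j + (if t then 0 else 24) + 24 ≤ 48 * m := by split_ifs <;> omega
  refine mul_mem (swapsAt_mem_blockPreserving hr hM (by decide)) ?_
  fin_cases k <;> exact swapsAt_mem_blockPreserving hr hM (by decide)

/-- Each generator is the product of its variable gadget, its assignment gadget and a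
block-preserving permutation of the symbols of the clause gadgets. -/
lemma exists_gen_eq_mul (n m : ℕ) (φ : Fin m → Fin 3 → Fin n × Bool) (i : Fin n) (b : Bool) :
    ∃ c ∈ blockPreserving (48 * m),
      gen n m φ i b = varGadget m i b * assignGadget m n i * c := by
  refine ⟨_, Submonoid.list_prod_mem _ fun f hf => ?_, rfl⟩
  obtain ⟨j, -, rfl⟩ := List.mem_map.mp hf
  refine Submonoid.list_prod_mem _ fun f hf => ?_
  obtain ⟨k, -, rfl⟩ := List.mem_map.mp hf
  split_ifs
  · exact clauseGadget_mem_blockPreserving j.isLt k _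
  · exact one_mem _

lemma varGadget_true_apply (m i x : ℕ) :
    varGadget m i true x =
      if x = 48 * m + 10 * i + 1 then 48 * m + 10 * i + 4
      else if x = 48 * m + 10 * i + 4 then 48 * m + 10 * i + 1
      else if x = 48 * m + 10 * i + 7 then 48 * m + 10 * i + 10
      else if x = 48 * m + 10 * i + 10 then 48 * m + 10 * i + 7 else x := by
  simp only [varGadget, swapsAt, if_true, List.map_cons, List.map_nil, List.prod_cons,
    List.prod_nil, mul_one, Equiv.Perm.mul_apply, Equiv.swap_apply_def]
  split_ifs <;> omega

lemma varGadget_false_apply (m i x : ℕ) :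
    varGadget m i false x =
      if x = 48 * m + 10 * i + 1 then 48 * m + 10 * i + 7
      else if x = 48 * m + 10 * i + 7 then 48 * m + 10 * i + 1
      else if x = 48 * m + 10 * i + 4 then 48 * m + 10 * i + 10
      else if x = 48 * m + 10 * i + 10 then 48 * m + 10 * i + 4 else x := by
  simp only [varGadget, swapsAt, Bool.false_eq_true, if_false, List.map_cons, List.map_nil,
    List.prod_cons, List.prod_nil, mul_one, Equiv.Perm.mul_apply, Equiv.swap_apply_def]
  split_ifs <;> omega

lemma varGadget_apply_of_lt {m n i : ℕ} (hi : i < n) (b : Bool) {x : ℕ}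
    (hx : 48 * m + 10 * n < x) : varGadget m i b x = x := by
  cases b
  · rw [varGadget_false_apply]; split_ifs <;> omega
  · rw [varGadget_true_apply]; split_ifs <;> omega

lemma varGadget_apply_of_le {m i : ℕ} (b : Bool) {x : ℕ} (hx : x ≤ 48 * m) :
    varGadget m i b x = x := by
  cases b
  · rw [varGadget_false_apply]; split_ifs <;> omega
  · rw [varGadget_true_apply]; split_ifs <;> omega

lemma assignGadget_apply_of_le {m n i x : ℕ} (hx : x ≤ 48 * m + 10 * n) :
    assignGadget m n i x = x := by
  simp only [assignGadget, Equiv.Perm.mul_apply, Equiv.swap_apply_def]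
  split_ifs <;> omega

lemma lt_assignGadget_apply {m n i x : ℕ} (hx : 48 * m + 10 * n < x) :
    48 * m + 10 * n < assignGadget m n i x := by
  simp only [assignGadget, Equiv.Perm.mul_apply, Equiv.swap_apply_def]
  split_ifs <;> omega

lemma assignGadget_apply_apply (m n i x : ℕ) :
    assignGadget m n i (assignGadget m n i x) = x := by
  simp only [assignGadget, Equiv.Perm.mul_apply, Equiv.swap_apply_def]
  generalize (i + 1) % n = a
  split_ifs <;> omega

section GeneratorProduct

variable {n m : ℕ} (φ : Fin m → Fin 3 → Fin n × Bool) (i : Fin n)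

lemma gen_apply_div_of_le (b : Bool) {x : ℕ} (hx : x ≤ 48 * m) :
    (gen n m φ i b x + 7) / 8 = (x + 7) / 8 := by
  obtain ⟨c, hc, h⟩ := exists_gen_eq_mul n m φ i b
  have hcx := (hc x).1
  rw [h, Equiv.Perm.mul_apply, Equiv.Perm.mul_apply,
    assignGadget_apply_of_le (by omega), varGadget_apply_of_le b (by omega), hcx]

lemma gen_apply_of_lt (b : Bool) {x : ℕ} (hx : 48 * m < x) :
    gen n m φ i b x = varGadget m i b (assignGadget m n i x) := by
  obtain ⟨c, hc, h⟩ := exists_gen_eq_mul n m φ i b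
  rw [h, Equiv.Perm.mul_apply, Equiv.Perm.mul_apply, (hc x).2 hx]

lemma gen_mul_gen'_apply_of_lt_of_le {x : ℕ} (h₁ : 48 * m < x) (h₂ : x ≤ 48 * m + 10 * n) :
    (gen n m φ i true * gen n m φ i false) x =
      varGadget m i true (varGadget m i false x) := by
  have hi := i.isLt
  have hv : 48 * m < varGadget m i false x ∧ varGadget m i false x ≤ 48 * m + 10 * n := by
    rw [varGadget_false_apply]; split_ifs <;> omega
  rw [Equiv.Perm.mul_apply, gen_apply_of_lt φ i false h₁, assignGadget_apply_of_le h₂,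
    gen_apply_of_lt φ i true hv.1, assignGadget_apply_of_le hv.2]

lemma gen_mul_gen'_apply_of_lt {x : ℕ} (hx : 48 * m + 10 * n < x) :
    (gen n m φ i true * gen n m φ i false) x = x := by
  have hu := lt_assignGadget_apply (i := i) hx
  rw [Equiv.Perm.mul_apply, gen_apply_of_lt φ i false (by omega),
    varGadget_apply_of_lt i.isLt false hu, gen_apply_of_lt φ i true (by omega),
    assignGadget_apply_apply, varGadget_apply_of_lt i.isLt true hx]

end GeneratorProduct

/-- For every `i ∈ [n]`, the product `g_i∘g'_i` of the two generators associated with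
the variable `x_i` has Chebyshev weight exactly `9`. -/
theorem gen_mul_gen'_weight (n m : ℕ) (hn : 1 ≤ n) (hm : 1 ≤ m)
    (φ : Fin m → Fin 3 → Fin n × Bool) (i : Fin n) :
    chebWeight (48 * m + 18 * n) (gen n m φ i true * gen n m φ i false) = 9 := by
  have hi := i.isLt
  refine le_antisymm (Finset.sup_le fun x _ => ?_) ?_
  · rcases le_or_gt x (48 * m) with h | h
    · have h₁ := gen_apply_div_of_le φ i false h
      have h₂ := gen_apply_div_of_le φ i true (x := gen n m φ i false x) (by omega)
      rw [Equiv.Perm.mul_apply, Nat.dist]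
      omega
    · rcases le_or_gt x (48 * m + 10 * n) with h' | h'
      · rw [gen_mul_gen'_apply_of_lt_of_le φ i h h', varGadget_true_apply,
          varGadget_false_apply, Nat.dist]
        split_ifs <;> omega
      · rw [gen_mul_gen'_apply_of_lt φ i h', Nat.dist_self]
        exact Nat.zero_le 9
  · have hx : 48 * m + 10 * i + 1 ∈ Finset.Icc 1 (48 * m + 18 * n) :=
      Finset.mem_Icc.mpr (by omega)
    refine le_trans ?_ (Finset.le_sup (f := fun x =>
      Nat.dist ((gen n m φ i true * gen n m φ i false) x) x) hx)
    rw [gen_mul_gen'_apply_of_lt_of_le φ i (by omega) (by omega), varGadget_true_apply,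
      varGadget_false_apply, Nat.dist]
    split_ifs <;> omega
end

section
/- (Main Theorem) If the formula φ is NAE-satisfiable (some assignment gives every clause both a true and a false literal), then the minimum Chebyshev weight over non-identity elements of H equals 6; if φ is not NAE-satisfiable, then this minimum equals 7. In particular, φ is NAE-satisfiable if and only if H contains a non-identity element of weight at most 6. -/
/-- The element `π_σ = ∏_{i : σ(x_i)=T} g_i ∘ ∏_{i : σ(x_i)=F} g'_i` of `H`
corresponding to a truth assignment `σ` (where `σ i = true` means `x_{i+1} = T`). -/
def piSigma (n m : ℕ) (φ : Fin m → Fin 3 → Fin n × Bool) (σ : Fin n → Bool) :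
    Equiv.Perm ℕ :=
  (((List.finRange n).filter fun i => σ i).map fun i => gen n m φ i true).prod *
  (((List.finRange n).filter fun i => !σ i).map fun i => gen n m φ i false).prod

/-- `σ` NAE-satisfies `φ`: in every clause, not all three literals receive the same
truth value under `σ` (the literal `(v, pos)` is true under `σ` iff `σ v = pos`). -/
def NAESat (n m : ℕ) (φ : Fin m → Fin 3 → Fin n × Bool) (σ : Fin n → Bool) : Prop :=
  ∀ j : Fin m, ∃ k k' : Fin 3,
    (σ (φ j k).1 == (φ j k).2) ≠ (σ (φ j k').1 == (φ j k').2)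

/- ### Cells

The points moved by the generators split into cells, on each of which every element of the group
acts as a translation of the elementary abelian group `(ZMod 2)³`. -/

namespace NAEReduction

/-- The group of translations acting on each cell. -/
abbrev Mask := ZMod 2 × ZMod 2 × ZMod 2

/-- The cells: three blocks of eight points for each of the two copies of a clause gadget, four
points for each variable gadget, and two points for each assignment gadget. -/
inductive Cell (m n : ℕ)
  | clause (j : Fin m) (t : Bool) (b : Fin 3)
  | var (i : Fin n)
  | assign (i : Fin n)

/-- The position of a point of the block `b` of a clause gadget. -/
def clauseSlot (b : Fin 3) (y : Mask) : ℕ :=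
  8 * b + 1 + (4 * y.1.val + 2 * y.2.1.val + y.2.2.val)

/-- The position of a point of a variable gadget. -/
def varSlot (y : Mask) : ℕ := 1 + 3 * (2 * y.2.1.val + y.2.2.val)

/-- The position of a point of an assignment gadget. -/
def assignSlot (y : Mask) : ℕ := 1 + 7 * y.2.2.val

/-- The points of a cell, parametrised by masks (not injectively for the smaller cells). -/
def point {m n : ℕ} : Cell m n → Mask → ℕ
  | .clause j t b, y => (48 * (j : ℕ) + if t then 0 else 24) + clauseSlot b y
  | .var i, y => 48 * m + 10 * (i : ℕ) + varSlot y
  | .assign i, y => 48 * m + 10 * n + 8 * (i : ℕ) + assignSlot y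

/-- `π` translates each cell `c` by `M c` and fixes every point outside the cells. -/
def Translates {m n : ℕ} (π : Equiv.Perm ℕ) (M : Cell m n → Mask) : Prop :=
  (∀ c y, π (point c y) = point c (y + M c)) ∧ ∀ x, (∀ c : Cell m n, ∀ y, x ≠ point c y) → π x = x

/-- The translation by which `g ∘ h_{k+1}` acts on the block `b`. -/
def blockMask : Fin 3 → Fin 3 → Mask
  | 0, 0 => (1, 0, 1) | 0, 1 => (0, 1, 1) | 0, 2 => (0, 0, 1)
  | 1, 0 => (0, 1, 1) | 1, 1 => (0, 0, 1) | 1, 2 => (1, 0, 1)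
  | 2, 0 => (0, 0, 1) | 2, 1 => (1, 0, 1) | 2, 2 => (0, 1, 1)

/-- The translation by which the variable gadget of value `b` acts. -/
def varMask (b : Bool) : Mask := if b then (0, 0, 1) else (0, 1, 0)

/-- The translations of a clause gadget. -/
def clauseGadgetMask {m n : ℕ} (j : Fin m) (k : Fin 3) (t : Bool) : Cell m n → Mask
  | .clause j' t' b => if j' = j ∧ t' = t then blockMask k b else 0
  | _ => 0

/-- The translations of a variable gadget. -/
def varGadgetMask {m n : ℕ} (i : Fin n) (b : Bool) : Cell m n → Mask
  | .var i' => if i' = i then varMask b else 0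
  | _ => 0

/-- The translations of one of the two transpositions of an assignment gadget. -/
def assignSwapMask {m n : ℕ} (i : Fin n) : Cell m n → Mask
  | .assign i' => if i' = i then (0, 0, 1) else 0
  | _ => 0

/-- The translations of a product in which `gen n m φ i b` has total exponent `a i b`. -/
def totalMask {m n : ℕ} [NeZero n] (φ : Fin m → Fin 3 → Fin n × Bool)
    (a : Fin n → Bool → ZMod 2) : Cell m n → Mask
  | .clause j t b => ∑ k, a (φ j k).1 ((φ j k).2 == t) • blockMask k b
  | .var i => a i true • varMask true + a i false • varMask false
  | .assign i => (a i true + a i false + (a (i - 1) true + a (i - 1) false)) • ((0, 0, 1) : Mask)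

section Translates

variable {m n : ℕ} {π ρ : Equiv.Perm ℕ} {M L : Cell m n → Mask}

lemma Translates.one : Translates (1 : Equiv.Perm ℕ) (0 : Cell m n → Mask) := by
  simp [Translates]

lemma Translates.mul (hπ : Translates π M) (hρ : Translates ρ L) :
    Translates (π * ρ) (M + L) := by
  refine ⟨fun c y => ?_, fun x hx => ?_⟩
  · rw [Equiv.Perm.mul_apply, hρ.1, hπ.1, Pi.add_apply, add_assoc, add_comm (L c)]
  · rw [Equiv.Perm.mul_apply, hρ.2 x hx, hπ.2 x hx]

lemma Translates.inv (hπ : Translates π M) : Translates π⁻¹ (-M) := by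
  refine ⟨fun c y => ?_, fun x hx => ?_⟩
  · rw [Equiv.Perm.inv_eq_iff_eq, hπ.1, Pi.neg_apply, neg_add_cancel_right]
  · rw [Equiv.Perm.inv_eq_iff_eq, hπ.2 x hx]

lemma Translates.list_prod {ι : Type*} {f : ι → Equiv.Perm ℕ} {F : ι → Cell m n → Mask}
    (h : ∀ i, Translates (f i) (F i)) (l : List ι) :
    Translates (l.map f).prod (l.map F).sum := by
  induction l with
  | nil => exact .one
  | cons i l ih => simpa using (h i).mul ih

lemma Translates.eq_one (hπ : Translates π M) (hM : M = 0) : π = 1 := by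
  ext x
  by_cases hx : ∀ c : Cell m n, ∀ y, x ≠ point c y
  · rw [hπ.2 x hx, Equiv.Perm.one_apply]
  · push Not at hx
    obtain ⟨c, y, rfl⟩ := hx
    rw [hπ.1, hM, Pi.zero_apply, add_zero, Equiv.Perm.one_apply]

end Translates

/- ### Gadgets as translations -/

lemma swap_add_apply_add (r a b x : ℕ) :
    Equiv.swap (r + a) (r + b) (r + x) = r + Equiv.swap a b x := by
  simp only [Equiv.swap_apply_def, Nat.add_left_cancel_iff]
  split_ifs <;> rfl

lemma swapsAt_apply_add (r : ℕ) (l : List (ℕ × ℕ)) (x : ℕ) :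
    swapsAt r l (r + x) = r + swapsAt 0 l x := by
  induction l with
  | nil => rfl
  | cons p l ih =>
    simp only [swapsAt, List.map_cons, List.prod_cons, Equiv.Perm.mul_apply, zero_add] at ih ⊢
    rw [ih, swap_add_apply_add]

lemma swapsAt_apply_of_ne {r : ℕ} {l : List (ℕ × ℕ)} {x : ℕ}
    (h : ∀ p ∈ l, x ≠ r + p.1 ∧ x ≠ r + p.2) : swapsAt r l x = x := by
  induction l with
  | nil => rfl
  | cons p l ih =>
    simp only [List.mem_cons, forall_eq_or_imp] at h
    have := ih h.2
    simp only [swapsAt, List.map_cons, List.prod_cons, Equiv.Perm.mul_apply] at this ⊢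
    rw [this, Equiv.swap_apply_of_ne_of_ne h.1.1 h.1.2]

lemma swapsAt_apply_of_outside {r d x : ℕ} {l : List (ℕ × ℕ)}
    (hl : ∀ p ∈ l, (1 ≤ p.1 ∧ p.1 ≤ d) ∧ 1 ≤ p.2 ∧ p.2 ≤ d) (hx : x ≤ r ∨ r + d < x) :
    swapsAt r l x = x :=
  swapsAt_apply_of_ne fun p hp => by
    have := hl p hp
    omega

lemma gPerm_mul_hPerm_apply_add (r : ℕ) (k : Fin 3) (x : ℕ) :
    (gPerm r * hPerm r k) (r + x) = r + (gPerm 0 * hPerm 0 k) x := by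
  fin_cases k <;>
    simp only [gPerm, hPerm, Equiv.Perm.mul_apply, swapsAt_apply_add]

lemma gPerm_mul_hPerm_apply_of_outside {r x : ℕ} (k : Fin 3) (hx : x ≤ r ∨ r + 24 < x) :
    (gPerm r * hPerm r k) x = x := by
  have hh : hPerm r k x = x := by
    fin_cases k <;> exact swapsAt_apply_of_outside (by decide) hx
  have hg : gPerm r x = x := swapsAt_apply_of_outside (by decide) hx
  rw [Equiv.Perm.mul_apply, hh, hg]

lemma gPerm_mul_hPerm_clauseSlot : ∀ (k b : Fin 3) (y : Mask),
    (gPerm 0 * hPerm 0 k) (clauseSlot b y) = clauseSlot b (y + blockMask k b) := by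
  decide +kernel

lemma clauseSlot_bounds : ∀ (b : Fin 3) (y : Mask), 1 ≤ clauseSlot b y ∧ clauseSlot b y ≤ 24 := by
  decide

lemma varSlot_bounds : ∀ y : Mask, 1 ≤ varSlot y ∧ varSlot y ≤ 10 := by
  decide

lemma assignSlot_bounds : ∀ y : Mask, 1 ≤ assignSlot y ∧ assignSlot y ≤ 8 := by
  decide

lemma exists_clauseSlot_eq : ∀ d : Fin 24, ∃ (b : Fin 3) (y : Mask), clauseSlot b y = d + 1 := by
  decide +kernel

lemma translates_clauseGadget {m n : ℕ} (j : Fin m) (k : Fin 3) (t : Bool) :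
    Translates (clauseGadget j k t) (clauseGadgetMask j k t : Cell m n → Mask) := by
  have hj := j.isLt
  refine ⟨fun c y => ?_, fun x hx => ?_⟩
  · cases c with
    | clause j' t' b =>
      by_cases h : j' = j ∧ t' = t
      · obtain ⟨rfl, rfl⟩ := h
        simp only [clauseGadget, point, clauseGadgetMask, and_self, if_true]
        rw [gPerm_mul_hPerm_apply_add, gPerm_mul_hPerm_clauseSlot]
      · simp only [clauseGadget, point, clauseGadgetMask, if_neg h, add_zero]
        refine gPerm_mul_hPerm_apply_of_outside k ?_
        have hs := clauseSlot_bounds b y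
        rw [Fin.ext_iff] at h
        cases t <;> cases t' <;> simp at h ⊢ <;> omega
    | var i =>
      simp only [clauseGadget, point, clauseGadgetMask, add_zero]
      refine gPerm_mul_hPerm_apply_of_outside k ?_
      have hs := varSlot_bounds y
      split_ifs <;> omega
    | assign i =>
      simp only [clauseGadget, point, clauseGadgetMask, add_zero]
      refine gPerm_mul_hPerm_apply_of_outside k ?_
      have hs := assignSlot_bounds y
      split_ifs <;> omega
  · refine gPerm_mul_hPerm_apply_of_outside k ?_
    by_contra! h
    obtain ⟨b, y, hy⟩ := exists_clauseSlot_eq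
      ⟨x - (48 * (j : ℕ) + if t then 0 else 24) - 1, by omega⟩
    refine hx (.clause j t b) y ?_
    simp only [point, hy]
    omega

lemma translates_varGadget {m n : ℕ} (i : Fin n) (b : Bool) :
    Translates (varGadget m i b) (varGadgetMask i b : Cell m n → Mask) := by
  have hi := i.isLt
  have slot : ∀ (b : Bool) (y : Mask),
      swapsAt 0 (if b then [(1, 4), (7, 10)] else [(1, 7), (4, 10)]) (varSlot y) =
        varSlot (y + varMask b) := by decide +kernel
  have eq : varGadget m i b =
      swapsAt (48 * m + 10 * i) (if b then [(1, 4), (7, 10)] else [(1, 7), (4, 10)]) := by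
    cases b <;> rfl
  have outside : ∀ x, x ≠ 48 * m + 10 * i + 1 → x ≠ 48 * m + 10 * i + 4 →
      x ≠ 48 * m + 10 * i + 7 → x ≠ 48 * m + 10 * i + 10 → varGadget m i b x = x := by
    intro x h₁ h₂ h₃ h₄
    rw [eq]
    refine swapsAt_apply_of_ne ?_
    cases b <;> simp [h₁, h₂, h₃, h₄]
  refine ⟨fun c y => ?_, fun x hx => ?_⟩
  · cases c with
    | clause j t c =>
      simp only [varGadgetMask, add_zero]
      have hs := clauseSlot_bounds c y
      have hj := j.isLt
      apply outside <;> simp only [point] <;> split_ifs <;> omega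
    | var i' =>
      by_cases h : i' = i
      · subst h
        simp only [point, varGadgetMask, if_true]
        rw [eq, swapsAt_apply_add, slot]
      · simp only [varGadgetMask, if_neg h, add_zero]
        have hs := varSlot_bounds y
        rw [Fin.ext_iff] at h
        apply outside <;> simp only [point] <;> omega
    | assign i' =>
      simp only [varGadgetMask, add_zero]
      have hs := assignSlot_bounds y
      apply outside <;> simp only [point] <;> omega
  · exact outside x (hx (.var i) (0, 0, 0)) (hx (.var i) (0, 0, 1)) (hx (.var i) (0, 1, 0))
      (hx (.var i) (0, 1, 1))

lemma translates_assignSwap {m n : ℕ} (i : Fin n) :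
    Translates
      (Equiv.swap (48 * m + 10 * n + 8 * (i : ℕ) + 1) (48 * m + 10 * n + 8 * (i : ℕ) + 8))
      (assignSwapMask i : Cell m n → Mask) := by
  have hi := i.isLt
  have slot : ∀ y : Mask, Equiv.swap 1 8 (assignSlot y) = assignSlot (y + (0, 0, 1)) := by
    decide +kernel
  refine ⟨fun c y => ?_, fun x hx => ?_⟩
  · cases c with
    | clause j t c =>
      simp only [assignSwapMask, add_zero]
      have hs := clauseSlot_bounds c y
      have hj := j.isLt
      apply Equiv.swap_apply_of_ne_of_ne <;> simp only [point] <;> split_ifs <;> omega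
    | var i' =>
      simp only [assignSwapMask, add_zero]
      have hs := varSlot_bounds y
      apply Equiv.swap_apply_of_ne_of_ne <;> simp only [point] <;> omega
    | assign i' =>
      by_cases h : i' = i
      · subst h
        simp only [point, assignSwapMask, if_true]
        rw [swap_add_apply_add, slot]
      · simp only [assignSwapMask, if_neg h, add_zero]
        have hs := assignSlot_bounds y
        rw [Fin.ext_iff] at h
        apply Equiv.swap_apply_of_ne_of_ne <;> simp only [point] <;> omega
  · exact Equiv.swap_apply_of_ne_of_ne (hx (.assign i) (0, 0, 0)) (hx (.assign i) (0, 0, 1))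

/- ### Elements of the group as translations -/

section Group

variable {m n : ℕ} [NeZero n] (φ : Fin m → Fin 3 → Fin n × Bool)

lemma totalMask_zero : totalMask φ 0 = 0 := by
  ext1 c
  cases c <;> simp [totalMask]

lemma totalMask_add (a a' : Fin n → Bool → ZMod 2) :
    totalMask φ (a + a') = totalMask φ a + totalMask φ a' := by
  ext1 c
  cases c with
  | clause j t b => simp only [totalMask, Pi.add_apply, add_smul, Finset.sum_add_distrib]
  | var i => simp only [totalMask, Pi.add_apply, add_smul]; abel
  | assign i => simp only [totalMask, Pi.add_apply, add_smul]; abel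

lemma totalMask_neg (a : Fin n → Bool → ZMod 2) : totalMask φ (-a) = -totalMask φ a := by
  rw [eq_neg_iff_add_eq_zero, ← totalMask_add, neg_add_cancel, totalMask_zero]

lemma totalMask_single (i : Fin n) (b : Bool) :
    totalMask φ (Pi.single i (Pi.single b 1)) =
      varGadgetMask i b + (assignSwapMask i + assignSwapMask (i + 1)) +
        ∑ j, ∑ k, if (φ j k).1 = i then clauseGadgetMask j k ((φ j k).2 == b) else 0 := by
  ext1 c
  cases c with
  | clause j t d =>
    simp only [totalMask, varGadgetMask, assignSwapMask, Pi.add_apply, Finset.sum_apply]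
    rw [Finset.sum_eq_single j]
    · rw [add_zero, zero_add, zero_add]
      refine Finset.sum_congr rfl fun k _ => ?_
      by_cases h : (φ j k).1 = i
      · subst h
        cases b <;> cases t <;> cases (φ j k).2 <;> simp [clauseGadgetMask]
      · simp [h]
    · intro j' _ hj'
      refine Finset.sum_eq_zero fun k _ => ?_
      split_ifs <;> simp [clauseGadgetMask, hj'.symm]
    · simp
  | var i' =>
    have : (∑ j, ∑ k, if (φ j k).1 = i then clauseGadgetMask j k ((φ j k).2 == b) else 0)
        (Cell.var i' : Cell m n) = 0 := by
      simp only [Finset.sum_apply]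
      refine Finset.sum_eq_zero fun j _ => Finset.sum_eq_zero fun k _ => ?_
      split_ifs <;> rfl
    rw [Pi.add_apply, this]
    by_cases h : i' = i
    · subst h
      cases b <;> simp [totalMask, varGadgetMask, assignSwapMask]
    · simp [totalMask, varGadgetMask, assignSwapMask, h]
  | assign i' =>
    have : (∑ j, ∑ k, if (φ j k).1 = i then clauseGadgetMask j k ((φ j k).2 == b) else 0)
        (Cell.assign i' : Cell m n) = 0 := by
      simp only [Finset.sum_apply]
      refine Finset.sum_eq_zero fun j _ => Finset.sum_eq_zero fun k _ => ?_
      split_ifs <;> rfl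
    rw [Pi.add_apply, this]
    have value : ∀ q : Fin n, (Pi.single i (Pi.single b 1) : Fin n → Bool → ZMod 2) q true +
        (Pi.single i (Pi.single b 1) : Fin n → Bool → ZMod 2) q false = if q = i then 1 else 0 := by
      intro q
      by_cases h : q = i
      · subst h
        cases b <;> simp
      · simp [h]
    simp only [totalMask, varGadgetMask, assignSwapMask, Pi.add_apply, value, add_smul,
      sub_eq_iff_eq_add, ite_smul, one_smul, zero_smul, zero_add, add_zero]

lemma translates_gen (i : Fin n) (b : Bool) :
    Translates (gen n m φ i b) (totalMask φ (Pi.single i (Pi.single b 1))) := by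
  rw [totalMask_single, Fin.sum_univ_def]
  have hi : ((i + 1 : Fin n) : ℕ) = ((i : ℕ) + 1) % n := by
    rw [Fin.val_add, Fin.val_one', Nat.add_mod_mod]
  refine ((translates_varGadget i b).mul ?_).mul (.list_prod (fun j => ?_) _)
  · have h := (translates_assignSwap (m := m) i).mul (translates_assignSwap (m := m) (i + 1))
    rwa [hi] at h
  · rw [Fin.sum_univ_def]
    refine .list_prod (fun k => ?_) _
    split_ifs
    · exact translates_clauseGadget j k _
    · exact .one

lemma exists_translates_of_mem {π : Equiv.Perm ℕ} (hπ : π ∈ Hgroup n m φ) :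
    ∃ a : Fin n → Bool → ZMod 2, Translates π (totalMask φ a) := by
  induction hπ using Subgroup.closure_induction with
  | mem _ h =>
    obtain ⟨p, rfl⟩ := h
    exact ⟨_, translates_gen φ p.1 p.2⟩
  | one => exact ⟨0, by rw [totalMask_zero]; exact .one⟩
  | mul _ _ _ _ h h' =>
    obtain ⟨a, ha⟩ := h
    obtain ⟨a', ha'⟩ := h'
    exact ⟨a + a', by rw [totalMask_add]; exact ha.mul ha'⟩
  | inv _ _ h =>
    obtain ⟨a, ha⟩ := h
    exact ⟨-a, by rw [totalMask_neg]; exact ha.inv⟩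

/-- The exponents of the element of the group that corresponds to an assignment. -/
def assignmentExponents (σ : Fin n → Bool) (i : Fin n) (b : Bool) : ZMod 2 :=
  if b = σ i then 1 else 0

lemma exists_mem_translates_assignment (σ : Fin n → Bool) :
    ∃ π ∈ Hgroup n m φ, Translates π (totalMask φ (assignmentExponents σ)) := by
  refine ⟨((List.finRange n).map fun i => gen n m φ i (σ i)).prod,
    Subgroup.list_prod_mem _ ?_, ?_⟩
  · intro x hx
    obtain ⟨i, -, rfl⟩ := List.mem_map.mp hx
    exact Subgroup.subset_closure ⟨(i, σ i), rfl⟩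
  · have h := Translates.list_prod (fun i => translates_gen φ i (σ i)) (List.finRange n)
    rw [← Fin.sum_univ_def] at h
    have sum_eq : totalMask φ (assignmentExponents σ) =
        ∑ i, totalMask φ (Pi.single i (Pi.single (σ i) 1)) := by
      refine Eq.trans (congrArg (totalMask φ) ?_)
        (map_sum (AddMonoidHom.mk' (totalMask φ) (totalMask_add φ)) _ _)
      ext i b
      rw [Finset.sum_apply, Finset.sum_apply, Finset.sum_eq_single i]
      · simp [assignmentExponents, Pi.single_apply]
      · intro i' _ h
        simp [Pi.single_eq_of_ne h.symm]
      · simp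
    rwa [sum_eq]

end Group

/- ### Weights -/

section Weight

variable {m n : ℕ}

lemma dist_le_chebWeight {π : Equiv.Perm ℕ} {M : Cell m n → Mask} (hπ : Translates π M)
    (c : Cell m n) (y : Mask) :
    Nat.dist (point c (y + M c)) (point c y) ≤ chebWeight (48 * m + 18 * n) π := by
  rw [← hπ.1 c y]
  refine Finset.le_sup (f := fun i => Nat.dist (π i) i) ?_
  rw [Finset.mem_Icc]
  cases c with
  | clause j t b =>
    have := clauseSlot_bounds b y
    simp only [point]
    split_ifs <;> omega
  | var i =>
    have := varSlot_bounds y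
    simp only [point]
    omega
  | assign i =>
    have := assignSlot_bounds y
    simp only [point]
    omega

lemma chebWeight_le {N w : ℕ} {π : Equiv.Perm ℕ} {M : Cell m n → Mask} (hπ : Translates π M)
    (h : ∀ c y, Nat.dist (point c (y + M c)) (point c y) ≤ w) : chebWeight N π ≤ w := by
  refine Finset.sup_le fun x _ => ?_
  by_cases hx : ∀ c : Cell m n, ∀ y, x ≠ point c y
  · rw [hπ.2 x hx, Nat.dist_self]
    exact Nat.zero_le w
  · push Not at hx
    obtain ⟨c, y, rfl⟩ := hx
    rw [hπ.1]
    exact h c y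

variable [NeZero n] {φ : Fin m → Fin 3 → Fin n × Bool}

/-- The translation of the block `b` when the literals with `τ k = t` act on it. -/
def literalMask (τ : Fin 3 → Bool) (t : Bool) (b : Fin 3) : Mask :=
  ∑ k, (if τ k = t then (1 : ZMod 2) else 0) • blockMask k b

lemma totalMask_assignment_clause (σ : Fin n → Bool) (j : Fin m) (t : Bool) (b : Fin 3) :
    totalMask φ (assignmentExponents σ) (.clause j t b) =
      literalMask (fun k => σ (φ j k).1 == (φ j k).2) t b := by
  simp only [totalMask, literalMask, assignmentExponents]
  refine Finset.sum_congr rfl fun k _ => ?_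
  congr 2
  cases t <;> cases (φ j k).2 <;> cases σ (φ j k).1 <;> simp

lemma dist_clauseSlot_literalMask_le : ∀ (τ : Fin 3 → Bool) (t : Bool) (b : Fin 3) (y : Mask),
    Nat.dist (clauseSlot b (y + literalMask τ t b)) (clauseSlot b y) ≤ 7 ∧
    ((∃ k k', τ k ≠ τ k') →
      Nat.dist (clauseSlot b (y + literalMask τ t b)) (clauseSlot b y) ≤ 6) := by
  decide +kernel

lemma exists_le_dist_clauseSlot_literalMask : ∀ τ : Fin 3 → Bool,
    ∃ (t : Bool) (b : Fin 3) (y : Mask),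
      6 ≤ Nat.dist (clauseSlot b (y + literalMask τ t b)) (clauseSlot b y) ∧
      ((∀ k k', τ k = τ k') →
        7 ≤ Nat.dist (clauseSlot b (y + literalMask τ t b)) (clauseSlot b y)) := by
  decide +kernel

lemma exists_clause_le_dist (σ : Fin n → Bool) (j : Fin m) :
    ∃ (c : Cell m n) (y : Mask),
      6 ≤ Nat.dist (point c (y + totalMask φ (assignmentExponents σ) c)) (point c y) ∧
      ((∀ k k', (σ (φ j k).1 == (φ j k).2) = (σ (φ j k').1 == (φ j k').2)) →
        7 ≤ Nat.dist (point c (y + totalMask φ (assignmentExponents σ) c)) (point c y)) := by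
  obtain ⟨t, b, y, h⟩ :=
    exists_le_dist_clauseSlot_literalMask fun k => σ (φ j k).1 == (φ j k).2
  refine ⟨.clause j t b, y, ?_⟩
  simpa only [totalMask_assignment_clause, point, Nat.dist_add_add_left] using h

lemma chebWeight_assignment_le {N : ℕ} {σ : Fin n → Bool} {π : Equiv.Perm ℕ}
    (hπ : Translates π (totalMask φ (assignmentExponents σ))) :
    chebWeight N π ≤ 7 ∧ (NAESat n m φ σ → chebWeight N π ≤ 6) := by
  have hvar : ∀ (s : Bool) (y : Mask), Nat.dist (varSlot (y +
      ((if true = s then (1 : ZMod 2) else 0) • varMask true +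
        (if false = s then (1 : ZMod 2) else 0) • varMask false))) (varSlot y) ≤ 6 := by
    decide +kernel
  have hassign : ∀ i : Fin n, totalMask φ (assignmentExponents σ) (.assign i) = 0 := by
    intro i
    simp only [totalMask, assignmentExponents]
    cases σ i <;> cases σ (i - 1) <;> decide
  have key : ∀ w, 6 ≤ w → (∀ (j : Fin m) (t : Bool) (b : Fin 3) (y : Mask),
      Nat.dist (clauseSlot b (y + literalMask (fun k => σ (φ j k).1 == (φ j k).2) t b))
        (clauseSlot b y) ≤ w) → chebWeight N π ≤ w := by
    intro w hw h
    refine chebWeight_le hπ fun c y => ?_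
    cases c with
    | clause j t b =>
      rw [totalMask_assignment_clause]
      simpa only [point, Nat.dist_add_add_left] using h j t b y
    | var i =>
      simp only [point, Nat.dist_add_add_left]
      exact (hvar (σ i) y).trans hw
    | assign i =>
      rw [hassign, add_zero, Nat.dist_self]
      exact Nat.zero_le w
  exact ⟨key 7 (by norm_num) fun j t b y => (dist_clauseSlot_literalMask_le _ t b y).1,
    fun hσ => key 6 le_rfl fun j t b y => (dist_clauseSlot_literalMask_le _ t b y).2 (hσ j)⟩

lemma apply_eq_apply_zero {α : Type*} {s : Fin n → α} (h : ∀ i, s i = s (i - 1)) (i : Fin n) :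
    s i = s 0 := by
  obtain ⟨k, hk⟩ := i
  induction k with
  | zero => rfl
  | succ k ih =>
    have pred : (⟨k + 1, hk⟩ - 1 : Fin n) = ⟨k, by omega⟩ := by
      rw [sub_eq_iff_eq_add, Fin.ext_iff, Fin.val_add, Fin.val_one', Nat.add_mod_mod,
        Nat.mod_eq_of_lt hk]
    rw [h, pred, ih]

lemma eq_assignmentExponents {a : Fin n → Bool → ZMod 2} {π : Equiv.Perm ℕ} (hπ1 : π ≠ 1)
    (hπ : Translates π (totalMask φ a)) (hw : chebWeight (48 * m + 18 * n) π ≤ 6) :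
    ∃ σ : Fin n → Bool, a = assignmentExponents σ := by
  have hvar : ∀ p q : ZMod 2,
      Nat.dist (varSlot (0 + (p • varMask true + q • varMask false))) (varSlot 0) ≤ 6 →
        p = 0 ∨ q = 0 := by
    decide
  have hassign : ∀ p q : ZMod 2,
      Nat.dist (assignSlot (0 + (p + q) • ((0, 0, 1) : Mask))) (assignSlot 0) ≤ 6 → p = q := by
    decide
  have hboth : ∀ i, a i true = 0 ∨ a i false = 0 := fun i => hvar _ _ <| by
    simpa only [point, Nat.dist_add_add_left, totalMask] using
      (dist_le_chebWeight hπ (.var i) 0).trans hw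
  have hstep : ∀ i, a i true + a i false = a (i - 1) true + a (i - 1) false :=
    fun i => hassign _ _ <| by
      simpa only [point, Nat.dist_add_add_left, totalMask] using
        (dist_le_chebWeight hπ (.assign i) 0).trans hw
  have hconst := apply_eq_apply_zero (s := fun i => a i true + a i false) hstep
  have bit : ∀ z : ZMod 2, z = 0 ∨ z = 1 := by decide
  rcases bit (a 0 true + a 0 false) with h0 | h1
  · refine absurd (hπ.eq_one ?_) hπ1
    have zero_of : ∀ p q : ZMod 2, p = 0 ∨ q = 0 → p + q = 0 → p = 0 ∧ q = 0 := by decide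
    have ha : a = 0 := by
      ext i b
      have h := zero_of _ _ (hboth i) ((hconst i).trans h0)
      cases b
      · exact h.2
      · exact h.1
    rw [ha, totalMask_zero]
  · have one_of : ∀ p q : ZMod 2, p + q = 1 → ∀ b : Bool,
        (if b then p else q) = if b = decide (p = 1) then 1 else 0 := by decide
    refine ⟨fun i => decide (a i true = 1), ?_⟩
    ext i b
    have h := one_of _ _ ((hconst i).trans h1) b
    cases b <;> simpa [assignmentExponents] using h

lemma exists_naeSat_of_chebWeight_le (hm : 1 ≤ m) {π : Equiv.Perm ℕ} (hπ : π ∈ Hgroup n m φ)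
    (hπ1 : π ≠ 1) (hw : chebWeight (48 * m + 18 * n) π ≤ 6) :
    (∃ σ, NAESat n m φ σ) ∧ 6 ≤ chebWeight (48 * m + 18 * n) π := by
  obtain ⟨a, ha⟩ := exists_translates_of_mem φ hπ
  obtain ⟨σ, rfl⟩ := eq_assignmentExponents hπ1 ha hw
  refine ⟨⟨σ, fun j => ?_⟩, ?_⟩
  · by_contra! h
    obtain ⟨c, y, -, h7⟩ := exists_clause_le_dist (φ := φ) σ j
    have := (h7 h).trans ((dist_le_chebWeight ha c y).trans hw)
    omega
  · obtain ⟨c, y, h6, -⟩ := exists_clause_le_dist (φ := φ) σ ⟨0, hm⟩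
    exact h6.trans (dist_le_chebWeight ha c y)

lemma exists_mem_chebWeight_le (hm : 1 ≤ m) (σ : Fin n → Bool) :
    ∃ π ∈ Hgroup n m φ, π ≠ 1 ∧ chebWeight (48 * m + 18 * n) π ≤ 7 ∧
      (NAESat n m φ σ → chebWeight (48 * m + 18 * n) π ≤ 6) := by
  obtain ⟨π, hπ, h⟩ := exists_mem_translates_assignment φ σ
  refine ⟨π, hπ, ?_, chebWeight_assignment_le h⟩
  rintro rfl
  obtain ⟨c, y, h6, -⟩ := exists_clause_le_dist (φ := φ) σ ⟨0, hm⟩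
  rw [← h.1, Equiv.Perm.one_apply, Nat.dist_self] at h6
  omega

end Weight

end NAEReduction

open NAEReduction


/-- (Main Theorem) If `φ` is NAE-satisfiable then the minimum Chebyshev weight over
non-identity elements of `H` equals `6`; otherwise it equals `7`.  In particular,
`φ` is NAE-satisfiable iff `H` contains a non-identity element of weight at most `6`. -/
theorem main_theorem (n m : ℕ) (hn : 1 ≤ n) (hm : 1 ≤ m)
    (φ : Fin m → Fin 3 → Fin n × Bool) :
    ((∃ σ : Fin n → Bool, NAESat n m φ σ) →
      sInf {d : ℕ | ∃ π ∈ Hgroup n m φ, π ≠ 1 ∧ d = chebWeight (48 * m + 18 * n) π} = 6) ∧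
    ((¬ ∃ σ : Fin n → Bool, NAESat n m φ σ) →
      sInf {d : ℕ | ∃ π ∈ Hgroup n m φ, π ≠ 1 ∧ d = chebWeight (48 * m + 18 * n) π} = 7) ∧
    ((∃ σ : Fin n → Bool, NAESat n m φ σ) ↔
      ∃ π ∈ Hgroup n m φ, π ≠ 1 ∧ chebWeight (48 * m + 18 * n) π ≤ 6) := by
  have : NeZero n := ⟨by omega⟩
  refine ⟨fun ⟨σ, hσ⟩ => ?_, fun hφ => ?_, fun ⟨σ, hσ⟩ => ?_, fun ⟨π, hπ, hπ1, hw⟩ =>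
    (exists_naeSat_of_chebWeight_le hm hπ hπ1 hw).1⟩
  · obtain ⟨π, hπ, hπ1, -, hw⟩ := exists_mem_chebWeight_le (φ := φ) hm σ
    refine IsLeast.csInf_eq ⟨⟨π, hπ, hπ1, ?_⟩, ?_⟩
    · exact le_antisymm (exists_naeSat_of_chebWeight_le hm hπ hπ1 (hw hσ)).2 (hw hσ)
    · rintro d ⟨ρ, hρ, hρ1, rfl⟩
      by_contra! h
      exact absurd (exists_naeSat_of_chebWeight_le hm hρ hρ1 h.le).2 h.not_ge
  · have lower : ∀ ρ ∈ Hgroup n m φ, ρ ≠ 1 → 7 ≤ chebWeight (48 * m + 18 * n) ρ := by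
      intro ρ hρ hρ1
      by_contra! h
      exact hφ (exists_naeSat_of_chebWeight_le hm hρ hρ1 (Nat.le_of_lt_succ h)).1
    obtain ⟨π, hπ, hπ1, hw, -⟩ := exists_mem_chebWeight_le (φ := φ) hm fun _ => true
    refine IsLeast.csInf_eq ⟨⟨π, hπ, hπ1, le_antisymm (lower π hπ hπ1) hw⟩, ?_⟩
    rintro d ⟨ρ, hρ, hρ1, rfl⟩
    exact lower ρ hρ hρ1
  · obtain ⟨π, hπ, hπ1, -, hw⟩ := exists_mem_chebWeight_le (φ := φ) hm σ
    exact ⟨π, hπ, hπ1, hw hσ⟩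
end

section
/- (Counterexample to the Cameron–Wu reduction) In S₅₂, define g₁ = (1,2)∘s₄(h₁), g′₁ = (1,2)∘s₂₈(h₁), g₂ = (3,4)∘s₄(h₁)∘s₂₈(h₁), g′₂ = (3,4), and g_c = s₄(g)∘s₂₈(g). Then g_c∘g₁∘g′₁ = s₄(g∘h₁)∘s₂₈(g∘h₁), this element lies in the group generated by {g₁, g′₁, g₂, g′₂, g_c}, it is not the identity, and its Chebyshev weight is 5. -/
/-- `g₁ = (1,2)∘s₄(h₁)` -/
def cwG1 : Equiv.Perm ℕ := Equiv.swap 1 2 * hPerm 4 0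
/-- `g′₁ = (1,2)∘s₂₈(h₁)` -/
def cwG1' : Equiv.Perm ℕ := Equiv.swap 1 2 * hPerm 28 0
/-- `g₂ = (3,4)∘s₄(h₁)∘s₂₈(h₁)` -/
def cwG2 : Equiv.Perm ℕ := Equiv.swap 3 4 * hPerm 4 0 * hPerm 28 0
/-- `g′₂ = (3,4)` -/
def cwG2' : Equiv.Perm ℕ := Equiv.swap 3 4
/-- `g_c = s₄(g)∘s₂₈(g)` -/
def cwGc : Equiv.Perm ℕ := gPerm 4 * gPerm 28

/-- A permutation fixing all the points moved by a product of transpositions commutes with it. -/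
theorem commute_swapsAt_of_fixes {σ : Equiv.Perm ℕ} {r : ℕ} {l : List (ℕ × ℕ)}
    (h : ∀ p ∈ l, σ (r + p.1) = r + p.1 ∧ σ (r + p.2) = r + p.2) :
    Commute σ (swapsAt r l) := by
  refine Commute.list_prod_right _ _ fun τ hτ => ?_
  obtain ⟨p, hp, rfl⟩ := List.mem_map.mp hτ
  obtain ⟨h₁, h₂⟩ := h p hp
  rw [commute_iff_eq, Equiv.mul_swap_eq_swap_mul, h₁, h₂]

theorem commute_swap_one_two_hPerm : Commute (Equiv.swap 1 2) (hPerm 4 0) :=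
  commute_swapsAt_of_fixes (by decide)

theorem commute_gPerm_hPerm : Commute (gPerm 28) (hPerm 4 0) :=
  commute_swapsAt_of_fixes (by decide +kernel)

theorem cwGc_mul_cwG1_mul_cwG1' :
    cwGc * cwG1 * cwG1' = (gPerm 4 * hPerm 4 0) * (gPerm 28 * hPerm 28 0) := by
  calc cwGc * cwG1 * cwG1'
      = gPerm 4 * gPerm 28 * (Equiv.swap 1 2 * hPerm 4 0) * (Equiv.swap 1 2 * hPerm 28 0) := rfl
    _ = gPerm 4 * (gPerm 28 * hPerm 4 0) * (Equiv.swap 1 2 * Equiv.swap 1 2) * hPerm 28 0 := by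
      rw [commute_swap_one_two_hPerm.eq]
      simp only [mul_assoc]
    _ = (gPerm 4 * hPerm 4 0) * (gPerm 28 * hPerm 28 0) := by
      rw [Equiv.swap_mul_self, mul_one, commute_gPerm_hPerm.eq]
      simp only [mul_assoc]

/-- (Counterexample to the Cameron–Wu reduction) In `S₅₂`:
`g_c∘g₁∘g′₁ = s₄(g∘h₁)∘s₂₈(g∘h₁)`, this element lies in the group generated by
`{g₁, g′₁, g₂, g′₂, g_c}`, it is not the identity, and its Chebyshev weight is `5`. -/
theorem cameron_wu_counterexample :
    cwGc * cwG1 * cwG1' = (gPerm 4 * hPerm 4 0) * (gPerm 28 * hPerm 28 0) ∧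
    cwGc * cwG1 * cwG1' ∈
      Subgroup.closure ({cwG1, cwG1', cwG2, cwG2', cwGc} : Set (Equiv.Perm ℕ)) ∧
    cwGc * cwG1 * cwG1' ≠ 1 ∧
    chebWeight 52 (cwGc * cwG1 * cwG1') = 5 := by
  refine ⟨cwGc_mul_cwG1_mul_cwG1', ?_, fun h => ?_, by decide +kernel⟩
  · exact mul_mem (mul_mem (Subgroup.subset_closure (by simp))
      (Subgroup.subset_closure (by simp))) (Subgroup.subset_closure (by simp))
  · have h5 : (cwGc * cwG1 * cwG1') 5 ≠ 5 := by decide +kernel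
    exact h5 (by rw [h, Equiv.Perm.one_apply])
end
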